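/- Let D' = D'¹ × ⋯ × D'ⁿ be a product Borel probability distribution on (0,∞)ⁿ and let ε ∈ (0,1). Let D'' be the product distribution obtained by pushing each D'ⁱ forward under the map that rounds every value v > 0 down to the largest number of the form (1−ε)^k with k ∈ ℤ that does not exceed v. Then Opt(D'') ≥ (1−ε)·Opt(D'). -/

import Mathlib

open MeasureTheory

/-- A (direct-revelation) mechanism for `n` buyers and one item: an allocation
rule and a payment rule on value profiles. -/
structure Mech (n : ℕ) where
  alloc : (Fin n → ℝ) → Fin n → ℝ
  pay : (Fin n → ℝ) → Fin n → ℝ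

/-- Allocation probabilities are in `[0,1]` and sum to at most `1`. -/
def Mech.Valid {n : ℕ} (M : Mech n) : Prop :=
  ∀ v : Fin n → ℝ, (∀ i, 0 ≤ M.alloc v i ∧ M.alloc v i ≤ 1) ∧ ∑ i, M.alloc v i ≤ 1

/-- Dominant strategy incentive compatibility (on nonnegative value profiles). -/
def Mech.DSIC {n : ℕ} (M : Mech n) : Prop :=
  ∀ (i : Fin n) (v : Fin n → ℝ), (∀ j, 0 ≤ v j) → ∀ v' : ℝ, 0 ≤ v' →
    v i * M.alloc (Function.update v i v') i - M.pay (Function.update v i v') i ≤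
      v i * M.alloc v i - M.pay v i

/-- Individual rationality (on nonnegative value profiles). -/
def Mech.IR {n : ℕ} (M : Mech n) : Prop :=
  ∀ v : Fin n → ℝ, (∀ j, 0 ≤ v j) → ∀ i, 0 ≤ v i * M.alloc v i - M.pay v i

/-- Measurability of the allocation and payment rules. -/
def Mech.Meas {n : ℕ} (M : Mech n) : Prop :=
  (∀ i, Measurable fun v => M.alloc v i) ∧ (∀ i, Measurable fun v => M.pay v i)

/-- A measurable DSIC and IR mechanism. -/
def Mech.Good {n : ℕ} (M : Mech n) : Prop := M.Valid ∧ M.DSIC ∧ M.IR ∧ M.Meas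

/-- Expected revenue of mechanism `M` on value distribution `D`. -/
noncomputable def Rev {n : ℕ} (M : Mech n) (D : Measure (Fin n → ℝ)) : ℝ :=
  ∫ v, ∑ i, M.pay v i ∂D

/-- Optimal revenue: supremum of revenue over measurable DSIC and IR mechanisms. -/
noncomputable def Opt {n : ℕ} (D : Measure (Fin n → ℝ)) : ℝ :=
  sSup {r : ℝ | ∃ M : Mech n, M.Good ∧ r = Rev M D}


/-- Round `v > 0` down to the largest power `(1-ε)^k`, `k ∈ ℤ`, not exceeding
`v` (junk value `0` for `v ≤ 0`). -/
noncomputable def roundPow (ε v : ℝ) : ℝ :=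
  if v ≤ 0 then 0 else (1 - ε) ^ (⌈Real.log v / Real.log (1 - ε)⌉ : ℤ)

lemma aux_int {h : ℝ → ℝ} (hm : MonotoneOn h (Set.Ici 0)) {a b : ℝ} (ha : 0 ≤ a) (hb : 0 ≤ b) :
    IntervalIntegrable h volume a b := by
  apply MonotoneOn.intervalIntegrable
  apply hm.mono
  intro x hx
  exact le_trans (le_inf ha hb) hx.1

/-- Myerson payments are incentive compatible. -/
lemma aux_dsic {h : ℝ → ℝ} (hm : MonotoneOn h (Set.Ici 0)) {v w : ℝ} (hv : 0 ≤ v) (hw : 0 ≤ w) :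
    (v - w) * h w ≤ (∫ t in (0:ℝ)..v, h t) - ∫ t in (0:ℝ)..w, h t := by
  rw [intervalIntegral.integral_interval_sub_left (aux_int hm le_rfl hv) (aux_int hm le_rfl hw)]
  rcases le_total w v with hle | hle
  · have := intervalIntegral.integral_mono_on (μ := volume) hle
      (intervalIntegrable_const (c := h w)) (aux_int hm hw hv)
      (fun x hx => hm hw (hw.trans hx.1) hx.1)
    simpa using this
  · have := intervalIntegral.integral_mono_on (μ := volume) hle
      (aux_int hm hv hw) (intervalIntegrable_const (c := h w))
      (fun x hx => hm (hv.trans hx.1) hw hx.2)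
    rw [intervalIntegral.integral_symm]
    simp at this
    linarith

/-- Any IC payment is bounded by the Myerson payment. -/
lemma aux_upper {h p : ℝ → ℝ} (hic : ∀ a b, 0 ≤ a → 0 ≤ b → a * h b - p b ≤ a * h a - p a)
    (h0 : ∀ t, 0 ≤ h t) (h1 : ∀ t, h t ≤ 1) (hm : MonotoneOn h (Set.Ici 0))
    (hp : p 0 ≤ 0) {v : ℝ} (hv : 0 ≤ v) : p v ≤ v * h v - ∫ t in (0:ℝ)..v, h t := by
  have key : ∀ N : ℕ, (∫ t in (0:ℝ)..v, h t) ≤ v * h v - p v + v / ((N:ℝ) + 1) := by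
    intro N
    set δ : ℝ := v / ((N:ℝ) + 1) with hδ
    have hN : (0:ℝ) < (N:ℝ) + 1 := by positivity
    have hδ0 : 0 ≤ δ := by positivity
    have hδN : δ * ((N:ℝ) + 1) = v := by rw [hδ]; field_simp
    have e1 : (∫ t in (0:ℝ)..v, h t) = δ * ∫ x in (0:ℝ)..(0 + ((N + 1 : ℕ) : ℝ)), h (δ * x) := by
      rw [intervalIntegral.mul_integral_comp_mul_left]
      push_cast
      simp [hδN]
    have e2 : (∫ x in (0:ℝ)..(0 + ((N + 1 : ℕ) : ℝ)), h (δ * x)) ≤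
        ∑ i ∈ Finset.range (N + 1), h (δ * (0 + ((i + 1 : ℕ) : ℝ))) := by
      apply MonotoneOn.integral_le_sum (f := fun x => h (δ * x))
      intro x hx y hy hxy
      exact hm (mul_nonneg hδ0 hx.1) (mul_nonneg hδ0 hy.1) (mul_le_mul_of_nonneg_left hxy hδ0)
    have e3 : ∑ i ∈ Finset.range (N + 1), h (δ * (0 + ((i + 1 : ℕ) : ℝ))) =
        ∑ i ∈ Finset.range (N + 1), h (δ * (i : ℝ)) + h v - h 0 := by
      have := Finset.sum_range_sub (fun i : ℕ => h (δ * (i : ℝ))) (N + 1)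
      rw [Finset.sum_sub_distrib] at this
      simp only [zero_add]
      push_cast at this ⊢
      rw [hδN, mul_zero] at this
      linarith
    have e4 : δ * ∑ i ∈ Finset.range (N + 1), h (δ * (i : ℝ)) ≤ v * h v - p v - (0 * h 0 - p 0) := by
      have := Finset.sum_range_sub
        (fun i : ℕ => (δ * (i : ℝ)) * h (δ * (i : ℝ)) - p (δ * (i : ℝ))) (N + 1)
      push_cast at this
      rw [hδN, mul_zero] at this
      rw [← this, Finset.mul_sum]
      apply Finset.sum_le_sum
      intro i _
      have := hic (δ * ((i : ℝ) + 1)) (δ * i) (by positivity) (by positivity)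
      nlinarith
    rw [e1]
    have := mul_le_mul_of_nonneg_left e2 hδ0
    rw [e3] at this
    have h5 : δ * (h v - h 0) ≤ δ * 1 := mul_le_mul_of_nonneg_left (by linarith [h0 0, h1 v]) hδ0
    nlinarith
  have lim : Filter.Tendsto (fun N : ℕ => v * h v - p v + v / ((N:ℝ) + 1)) Filter.atTop
      (nhds (v * h v - p v + 0)) := by
    apply Filter.Tendsto.const_add
    apply Filter.Tendsto.const_div_atTop
    exact Filter.tendsto_atTop_add_const_right _ _ tendsto_natCast_atTop_atTop
  have := ge_of_tendsto' lim key
  linarith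

lemma aux_compare {H ρ : ℝ → ℝ} {c : ℝ} (hc : 0 < c) (hH : MonotoneOn H (Set.Ici 0))
    (hρ : MonotoneOn ρ (Set.Ici 0)) (hρ0 : ∀ t, 0 ≤ t → 0 ≤ ρ t) (hρc : ∀ t, 0 ≤ t → c * ρ t ≤ t)
    {w : ℝ} (hw : 0 ≤ w) :
    c * (ρ w * H (ρ w) - ∫ t in (0:ℝ)..(ρ w), H t) ≤
      w * H (ρ w) - ∫ t in (0:ℝ)..w, H (ρ t) := by
  have hm : MonotoneOn (fun t => H (ρ t)) (Set.Ici 0) := fun a ha b hb hab =>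
    hH (hρ0 a ha) (hρ0 b hb) (hρ ha hb hab)
  have hm2 : MonotoneOn (fun t => H (c⁻¹ * t)) (Set.Ici 0) := fun a ha b hb hab =>
    hH (mul_nonneg (inv_nonneg.mpr hc.le) ha) (mul_nonneg (inv_nonneg.mpr hc.le) hb)
      (mul_le_mul_of_nonneg_left hab (inv_nonneg.mpr hc.le))
  have hcw : 0 ≤ c * ρ w := mul_nonneg hc.le (hρ0 w hw)
  have e1 : c * ∫ t in (0:ℝ)..(ρ w), H t = ∫ t in (0:ℝ)..(c * ρ w), H (c⁻¹ * t) := by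
    have := intervalIntegral.mul_integral_comp_mul_left (a := 0) (b := ρ w)
      (f := fun t => H (c⁻¹ * t)) c
    rw [mul_zero] at this
    rw [← this]
    simp [hc.ne']
  have e2 : (∫ t in (0:ℝ)..(c * ρ w), H (ρ t)) ≤ ∫ t in (0:ℝ)..(c * ρ w), H (c⁻¹ * t) := by
    apply intervalIntegral.integral_mono_on hcw (aux_int hm le_rfl hcw) (aux_int hm2 le_rfl hcw)
    intro x hx
    have hx2 : (0:ℝ) ≤ c⁻¹ * x := mul_nonneg (inv_nonneg.mpr hc.le) hx.1
    apply hH (hρ0 x hx.1) hx2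
    rw [le_inv_mul_iff₀ hc]
    exact hρc x hx.1
  have e3 := aux_dsic hm hcw hw
  have e4 := aux_dsic hm hw hcw
  have e5 : (∫ t in (0:ℝ)..w, H (ρ t)) - (∫ t in (0:ℝ)..(c * ρ w), H (ρ t)) ≤
      (w - c * ρ w) * H (ρ w) := by nlinarith
  nlinarith

lemma Mech.alloc_mono {n : ℕ} {M : Mech n} (hM : M.DSIC) (i : Fin n) (v : Fin n → ℝ)
    (hv : ∀ j, 0 ≤ v j) : MonotoneOn (fun t => M.alloc (Function.update v i t) i) (Set.Ici 0) := by
  intro a ha b hb hab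
  have hn : ∀ t, 0 ≤ t → ∀ j, 0 ≤ Function.update v i t j := by
    intro t ht j
    by_cases h : j = i
    · subst h; simpa using ht
    · simpa [h] using hv j
  have h1 := hM i _ (hn a ha) b hb
  have h2 := hM i _ (hn b hb) a ha
  simp only [Function.update_idem, Function.update_self] at h1 h2
  rcases hab.eq_or_lt with h | h
  · subst h; exact le_rfl
  · simp only
    by_contra hcon
    push Not at hcon
    nlinarith

/-- Composition of an allocation rule with value maps, with Myerson payments. -/
noncomputable def Mech.comp {n : ℕ} (M : Mech n) (ρ : Fin n → ℝ → ℝ) : Mech n where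
  alloc v := M.alloc (fun j => ρ j (v j))
  pay v i := v i * M.alloc (fun j => ρ j (v j)) i -
    v i * ∫ s in (0:ℝ)..1, M.alloc (fun j => ρ j (Function.update v i (v i * s) j)) i

lemma Mech.comp_pay {n : ℕ} (M : Mech n) (ρ : Fin n → ℝ → ℝ) (v : Fin n → ℝ) (i : Fin n) :
    (M.comp ρ).pay v i = v i * M.alloc (fun j => ρ j (v j)) i -
      ∫ t in (0:ℝ)..(v i), M.alloc (Function.update (fun j => ρ j (v j)) i (ρ i t)) i := by
  have := intervalIntegral.mul_integral_comp_mul_left (a := 0) (b := 1)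
      (f := fun t => M.alloc (fun j => ρ j (Function.update v i t j)) i) (v i)
  simp only [Mech.comp, this, mul_zero, mul_one]
  congr 2
  ext t
  congr 1
  ext j
  by_cases h : j = i
  · subst h; simp
  · simp [h]

structure RhoGood {n : ℕ} (c : ℝ) (ρ : Fin n → ℝ → ℝ) : Prop where
  meas : ∀ i, Measurable (ρ i)
  mono : ∀ i, MonotoneOn (ρ i) (Set.Ici 0)
  nonneg : ∀ i t, 0 ≤ t → 0 ≤ ρ i t
  le : ∀ i t, 0 ≤ t → c * ρ i t ≤ t

lemma Mech.comp_mono {n : ℕ} {M : Mech n} (hM : M.Good) {ρ : Fin n → ℝ → ℝ} {c : ℝ}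
    (hρ : RhoGood c ρ) (v : Fin n → ℝ) (hv : ∀ j, 0 ≤ v j) (i : Fin n) :
    MonotoneOn (fun t => M.alloc (Function.update (fun j => ρ j (v j)) i (ρ i t)) i)
      (Set.Ici 0) := fun a ha b hb hab =>
  M.alloc_mono hM.2.1 i _ (fun j => hρ.nonneg j _ (hv j)) (hρ.nonneg i a ha) (hρ.nonneg i b hb)
    (hρ.mono i ha hb hab)

lemma Mech.comp_good {n : ℕ} {M : Mech n} (hM : M.Good) {ρ : Fin n → ℝ → ℝ} {c : ℝ}
    (hρ : RhoGood c ρ) : (M.comp ρ).Good := by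
  have hfm : Measurable (fun v : Fin n → ℝ => fun j => ρ j (v j)) :=
    measurable_pi_lambda _ fun j => (hρ.meas j).comp (measurable_pi_apply j)
  refine ⟨fun v => hM.1 _, ?_, ?_, ?_, ?_⟩
  · intro i v hv v' hv'
    rw [Mech.comp_pay, Mech.comp_pay]
    have := aux_dsic (Mech.comp_mono hM hρ v hv i) (hv i) hv'
    have e : ∀ t, (fun j => ρ j (Function.update v i t j)) =
        Function.update (fun j => ρ j (v j)) i (ρ i t) := by
      intro t
      ext j
      by_cases h : j = i
      · subst h; simp
      · simp [h]
    simp only [Mech.comp, e, Function.update_idem, Function.update_self]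
    linarith
  · intro v hv i
    rw [Mech.comp_pay]
    simp only [Mech.comp]
    have : 0 ≤ ∫ t in (0:ℝ)..(v i), M.alloc (Function.update (fun j => ρ j (v j)) i (ρ i t)) i :=
      intervalIntegral.integral_nonneg (hv i) fun t _ => ((hM.1 _).1 i).1
    linarith
  · intro i
    exact (hM.2.2.2.1 i).comp hfm
  · intro i
    simp only [Mech.comp]
    have h1 := (hM.2.2.2.1 i).comp hfm
    refine ((measurable_pi_apply i).mul h1).sub ((measurable_pi_apply i).mul ?_)
    simp only [intervalIntegral.integral_of_le zero_le_one]
    apply StronglyMeasurable.measurable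
    apply StronglyMeasurable.integral_prod_right
    apply Measurable.stronglyMeasurable
    refine h1.comp (g := fun v => M.alloc (fun j => ρ j (v j)) i)
      (f := fun q : (Fin n → ℝ) × ℝ => Function.update q.1 i (q.1 i * q.2)) ?_
    exact measurable_update'.comp (measurable_fst.prodMk
      (((measurable_pi_apply i).comp measurable_fst).mul measurable_snd))

lemma Mech.comp_pay_nonneg {n : ℕ} {M : Mech n} (hM : M.Good) {ρ : Fin n → ℝ → ℝ} {c : ℝ}
    (hρ : RhoGood c ρ) (v : Fin n → ℝ) (hv : ∀ j, 0 ≤ v j) (i : Fin n) :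
    0 ≤ (M.comp ρ).pay v i := by
  rw [Mech.comp_pay]
  have := aux_dsic (Mech.comp_mono hM hρ v hv i) le_rfl (hv i)
  simp at this
  linarith

lemma Mech.comp_pay_ge {n : ℕ} {M : Mech n} (hM : M.Good) {ρ : Fin n → ℝ → ℝ} {c : ℝ}
    (hc : 0 < c) (hρ : RhoGood c ρ) (v : Fin n → ℝ) (hv : ∀ j, 0 ≤ v j) (i : Fin n) :
    c * M.pay (fun j => ρ j (v j)) i ≤ (M.comp ρ).pay v i := by
  rw [Mech.comp_pay]
  set V : Fin n → ℝ := fun j => ρ j (v j) with hV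
  have hV0 : ∀ j, 0 ≤ V j := fun j => hρ.nonneg j _ (hv j)
  have hmon := M.alloc_mono hM.2.1 i V hV0
  have h1 := aux_compare hc hmon (hρ.mono i) (hρ.nonneg i) (hρ.le i) (hv i)
  have e : Function.update V i (ρ i (v i)) = V := by simp [hV]
  have hn : ∀ t, 0 ≤ t → ∀ j, 0 ≤ Function.update V i t j := by
    intro t ht j
    by_cases h : j = i
    · subst h; simpa using ht
    · simpa [h] using hV0 j
  have h2 := aux_upper (h := fun t => M.alloc (Function.update V i t) i)
    (p := fun t => M.pay (Function.update V i t) i)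
    (fun a b ha hb => by
      have := hM.2.1 i _ (hn a ha) b hb
      simpa using this) (fun t => ((hM.1 _).1 i).1) (fun t => ((hM.1 _).1 i).2) hmon
    (by have := hM.2.2.1 _ (hn 0 le_rfl) i
        simpa using this) (hρ.nonneg i _ (hv i))
  simp only [e] at h1 h2
  exact le_trans (mul_le_mul_of_nonneg_left h2 hc.le) h1

/-- Expected positive part of the revenue. -/
noncomputable def LRev {n : ℕ} (M : Mech n) (D : Measure (Fin n → ℝ)) : ENNReal :=
  ∫⁻ v, ENNReal.ofReal (∑ i, M.pay v i) ∂D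

lemma ofReal_rev_le {n : ℕ} (M : Mech n) (D : Measure (Fin n → ℝ)) :
    ENNReal.ofReal (Rev M D) ≤ LRev M D := by
  unfold Rev LRev
  by_cases h : Integrable (fun v => ∑ i, M.pay v i) D
  · rw [integral_eq_lintegral_pos_part_sub_lintegral_neg_part h]
    refine le_trans (ENNReal.ofReal_le_ofReal (sub_le_self _ ENNReal.toReal_nonneg)) ?_
    exact ENNReal.ofReal_toReal_le
  · rw [integral_undef h]; simp

lemma LRev_comp {n : ℕ} {M : Mech n} (hM : M.Good) {ρ : Fin n → ℝ → ℝ} {c : ℝ}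
    (hc : 0 < c) (hρ : RhoGood c ρ) {D : Measure (Fin n → ℝ)} (hD : ∀ᵐ v ∂D, ∀ j, 0 ≤ v j) :
    ENNReal.ofReal c * ∫⁻ v, ENNReal.ofReal (∑ i, M.pay (fun j => ρ j (v j)) i) ∂D ≤
      LRev (M.comp ρ) D := by
  unfold LRev
  rw [← lintegral_const_mul' _ _ ENNReal.ofReal_ne_top]
  apply lintegral_mono_ae
  filter_upwards [hD] with v hv
  rw [← ENNReal.ofReal_mul hc.le, Finset.mul_sum]
  exact ENNReal.ofReal_le_ofReal (Finset.sum_le_sum fun i _ => Mech.comp_pay_ge hM hc hρ v hv i)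

lemma trunc_good {n : ℕ} {T : ℝ} (hT : 0 ≤ T) :
    RhoGood (n := n) 1 (fun _ t => min t T) where
  meas _ := measurable_id.min measurable_const
  mono _ a _ b _ hab := min_le_min_right T hab
  nonneg _ t ht := le_min ht hT
  le _ t _ := by simp

lemma trunc_le {n : ℕ} {M : Mech n} (hM : M.Good) {T : ℝ} (hT : 0 ≤ T) (v : Fin n → ℝ)
    (hv : ∀ j, 0 ≤ v j) (i : Fin n) : (M.comp (fun _ t => min t T)).pay v i ≤ T := by
  have hG := Mech.comp_good hM (trunc_good (n := n) hT)
  have hir := hG.2.2.1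
  have key : ∀ w : Fin n → ℝ, (∀ j, 0 ≤ w j) → w i ≤ T →
      (M.comp (fun _ t => min t T)).pay w i ≤ T := by
    intro w hw hwT
    have h1 := hir w hw i
    have h2 := (hG.1 w).1 i
    nlinarith [hw i]
  rcases le_total (v i) T with h | h
  · exact key v hv h
  · have h1 := hG.2.1 i v hv T hT
    have hu : ∀ j, 0 ≤ Function.update v i T j := by
      intro j
      by_cases h : j = i
      · subst h; simpa using hT
      · simpa [h] using hv j
    have h2 := key _ hu (by simp)
    have e : (M.comp (fun _ t => min t T)).alloc (Function.update v i T) i =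
        (M.comp (fun _ t => min t T)).alloc v i := by
      simp only [Mech.comp]
      congr 1
      ext j
      by_cases hj : j = i
      · subst hj; simp [h]
      · simp [hj]
    rw [e] at h1
    linarith

lemma bounded_approx {n : ℕ} {M : Mech n} (hM : M.Good) {D : Measure (Fin n → ℝ)}
    (hD : ∀ᵐ v ∂D, ∀ j, 0 ≤ v j) {K : ENNReal} (hK : K < LRev M D) :
    ∃ M' : Mech n, M'.Good ∧ (∃ T : ℝ, ∀ v : Fin n → ℝ, (∀ j, 0 ≤ v j) → ∀ i,
      0 ≤ M'.pay v i ∧ M'.pay v i ≤ T) ∧ K < LRev M' D := by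
  have hlim : ∀ v : Fin n → ℝ, Filter.liminf (fun N : ℕ =>
      ENNReal.ofReal (∑ i, M.pay (fun j => min (v j) (N:ℝ)) i)) Filter.atTop =
      ENNReal.ofReal (∑ i, M.pay v i) := by
    intro v
    apply Filter.Tendsto.liminf_eq
    apply tendsto_const_nhds.congr'
    have : ∀ᶠ N : ℕ in Filter.atTop, ∀ j, v j ≤ (N:ℝ) := by
      rw [Filter.eventually_all]
      intro j
      exact tendsto_natCast_atTop_atTop.eventually_ge_atTop (v j)
    filter_upwards [this] with N hN
    simp [hN]
  have hF := lintegral_liminf_le (μ := D) (u := Filter.atTop) (f := fun (N : ℕ) v =>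
      ENNReal.ofReal (∑ i, M.pay (fun j => min (v j) (N:ℝ)) i)) (fun N => by
    apply ENNReal.measurable_ofReal.comp
    apply Finset.measurable_sum
    intro i _
    exact (hM.2.2.2.2 i).comp (measurable_pi_lambda _ fun j =>
      (measurable_pi_apply j).min measurable_const))
  simp only [hlim] at hF
  have hlt := lt_of_lt_of_le hK hF
  obtain ⟨N, hN⟩ := (Filter.eventually_lt_of_lt_liminf hlt).exists
  have hT : (0:ℝ) ≤ N := Nat.cast_nonneg N
  refine ⟨M.comp (fun _ t => min t (N:ℝ)), Mech.comp_good hM (trunc_good hT), ⟨N, ?_⟩, ?_⟩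
  · intro v hv i
    exact ⟨Mech.comp_pay_nonneg hM (trunc_good hT) v hv i, trunc_le hM hT v hv i⟩
  · refine hN.trans_le ?_
    simpa using LRev_comp hM one_pos (trunc_good hT) hD

lemma zero_mem {n : ℕ} (D : Measure (Fin n → ℝ)) :
    (0:ℝ) ∈ {r : ℝ | ∃ M : Mech n, M.Good ∧ r = Rev M D} := by
  refine ⟨⟨fun _ _ => 0, fun _ _ => 0⟩, ⟨?_, ?_, ?_, ?_, ?_⟩, ?_⟩
  · intro v; simp
  · intro i v hv v' hv'; simp
  · intro v hv i; simp
  · intro i; exact measurable_const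
  · intro i; exact measurable_const
  · simp [Rev]

lemma Opt_nonneg {n : ℕ} (D : Measure (Fin n → ℝ)) : 0 ≤ Opt D := by
  unfold Opt
  by_cases h : BddAbove {r : ℝ | ∃ M : Mech n, M.Good ∧ r = Rev M D}
  · exact le_csSup h (zero_mem D)
  · rw [Real.sSup_of_not_bddAbove h]

lemma LRev_le_Opt {n : ℕ} {M : Mech n} (hM : M.Good) {D : Measure (Fin n → ℝ)}
    [IsProbabilityMeasure D] (hD : ∀ᵐ v ∂D, ∀ j, 0 ≤ v j)
    (hb : BddAbove {r : ℝ | ∃ M : Mech n, M.Good ∧ r = Rev M D}) :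
    LRev M D ≤ ENNReal.ofReal (Opt D) := by
  by_contra hcon
  push Not at hcon
  obtain ⟨M', hM', ⟨T, hT⟩, hlt⟩ := bounded_approx hM hD hcon
  have hle : Rev M' D ≤ Opt D := le_csSup hb ⟨M', hM', rfl⟩
  have hintegr : Integrable (fun v => ∑ i, M'.pay v i) D := by
    apply integrable_finsetSum
    intro i _
    refine Integrable.of_bound (hM'.2.2.2.2 i).aestronglyMeasurable T ?_
    filter_upwards [hD] with v hv
    rw [Real.norm_of_nonneg (hT v hv i).1]
    exact (hT v hv i).2
  have : ENNReal.ofReal (Rev M' D) = LRev M' D := by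
    apply ofReal_integral_eq_lintegral_ofReal hintegr
    filter_upwards [hD] with v hv
    exact Finset.sum_nonneg fun i _ => (hT v hv i).1
  rw [← this] at hlt
  exact absurd (ENNReal.ofReal_le_ofReal hle) (not_le.mpr hlt)

noncomputable def kap (ε t : ℝ) : ℤ := ⌈Real.log t / Real.log (1 - ε)⌉

noncomputable def rho (ε : ℝ) (a : ℤ → ℝ) (t : ℝ) : ℝ := if t ≤ 0 then 0 else a (kap ε t)

def AGood (ε : ℝ) (a : ℤ → ℝ) : Prop :=
  ∀ k, (1 - ε) ^ k ≤ a k ∧ (1 - ε) * a k < (1 - ε) ^ k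

lemma roundPow_eq (ε : ℝ) : roundPow ε = rho ε (fun k => (1 - ε) ^ k) := rfl

lemma AGood_pow {ε : ℝ} (hε : ε ∈ Set.Ioo (0:ℝ) 1) : AGood ε (fun k => (1 - ε) ^ k) := by
  intro k
  have h : 0 < (1 - ε) ^ k := zpow_pos (by linarith [hε.2]) k
  exact ⟨le_rfl, by nlinarith [hε.1]⟩

lemma kap_meas (ε : ℝ) : Measurable (kap ε) := by
  unfold kap
  exact Int.measurable_ceil.comp (Real.measurable_log.div_const _)

lemma rho_meas (ε : ℝ) (a : ℤ → ℝ) : Measurable (rho ε a) :=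
  Measurable.ite measurableSet_Iic measurable_const
    ((measurable_from_top (f := a)).comp (kap_meas ε))

lemma log_neg' {ε : ℝ} (hε : ε ∈ Set.Ioo (0:ℝ) 1) : Real.log (1 - ε) < 0 :=
  Real.log_neg (by linarith [hε.2]) (by linarith [hε.1])

lemma kap_le {ε : ℝ} (hε : ε ∈ Set.Ioo (0:ℝ) 1) {t : ℝ} (ht : 0 < t) :
    (1 - ε) ^ (kap ε t) ≤ t := by
  have hb : 0 < 1 - ε := by linarith [hε.2]
  rw [← Real.log_le_log_iff (zpow_pos hb _) ht, Real.log_zpow]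
  have := Int.le_ceil (Real.log t / Real.log (1 - ε))
  rw [div_le_iff_of_neg (log_neg' hε)] at this
  exact this

lemma lt_kap {ε : ℝ} (hε : ε ∈ Set.Ioo (0:ℝ) 1) {t : ℝ} (ht : 0 < t) :
    (1 - ε) * t < (1 - ε) ^ (kap ε t) := by
  have hb : 0 < 1 - ε := by linarith [hε.2]
  rw [← Real.log_lt_log_iff (mul_pos hb ht) (zpow_pos hb _), Real.log_zpow,
    Real.log_mul hb.ne' ht.ne']
  have := Int.ceil_lt_add_one (Real.log t / Real.log (1 - ε))
  have h2 := log_neg' hε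
  rw [← sub_lt_iff_lt_add, lt_div_iff_of_neg h2] at this
  change _ < (⌈Real.log t / Real.log (1 - ε)⌉ : ℝ) * _
  linarith

lemma kap_pow {ε : ℝ} (hε : ε ∈ Set.Ioo (0:ℝ) 1) (k : ℤ) : kap ε ((1 - ε) ^ k) = k := by
  unfold kap
  rw [Real.log_zpow, mul_div_assoc, div_self (log_neg' hε).ne]
  simp

lemma rho_round {ε : ℝ} (hε : ε ∈ Set.Ioo (0:ℝ) 1) (a : ℤ → ℝ) (t : ℝ) :
    rho ε a (roundPow ε t) = rho ε a t := by
  rw [roundPow_eq]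
  by_cases h : t ≤ 0
  · simp [rho, h]
  · have hb : 0 < (1 - ε) ^ (kap ε t) := zpow_pos (by linarith [hε.2]) _
    simp [rho, h, kap_pow hε, not_le.mpr hb]

lemma rho_good {n : ℕ} {ε : ℝ} (hε : ε ∈ Set.Ioo (0:ℝ) 1) {a : Fin n → ℤ → ℝ}
    (ha : ∀ i, AGood ε (a i)) : RhoGood (1 - ε) (fun i => rho ε (a i)) := by
  have hb : 0 < 1 - ε := by linarith [hε.2]
  have hpos : ∀ i k, 0 < a i k := fun i k => (zpow_pos hb k).trans_le (ha i k).1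
  refine ⟨fun i => rho_meas ε _, ?_, ?_, ?_⟩
  · intro i x hx y hy hxy
    have hanti : Antitone (a i) := by
      apply antitone_int_of_succ_le
      intro k
      have h1 := (ha i (k + 1)).2
      rw [zpow_add_one₀ hb.ne', mul_comm] at h1
      exact (lt_of_mul_lt_mul_right h1 hb.le).le.trans (ha i k).1
    by_cases h : x ≤ 0
    · by_cases h' : y ≤ 0
      · simp [rho, h, h']
      · simpa [rho, h, h'] using (hpos i _).le
    · have h' : ¬ y ≤ 0 := fun h' => h (hxy.trans h')
      simp only [rho, h, h', if_false]
      apply hanti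
      apply Int.ceil_mono
      apply div_le_div_of_nonpos_of_le (log_neg' hε).le
      exact Real.log_le_log (not_le.mp h) hxy
  · intro i t _
    by_cases h : t ≤ 0
    · simp [rho, h]
    · simpa [rho, h] using (hpos i _).le
  · intro i t ht
    by_cases h : t ≤ 0
    · simpa [rho, h] using ht
    · simp only [rho, h, if_false]
      exact (ha i _).2.le.trans (kap_le hε (not_le.mp h))

lemma choose_rep {ε : ℝ} (hε : ε ∈ Set.Ioo (0:ℝ) 1) (μ : Measure ℝ) [IsProbabilityMeasure μ]
    (hpos : μ (Set.Iic 0) = 0) (g : ℝ → ENNReal) (hfin : ∫⁻ t, g t ∂μ ≠ ⊤) :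
    ∃ a, AGood ε a ∧ ∫⁻ t, g t ∂μ ≤ ∫⁻ t, g (rho ε a t) ∂μ := by
  set B : ℤ → Set ℝ := fun k => Set.Ioi 0 ∩ kap ε ⁻¹' {k} with hB
  have hBm : ∀ k, MeasurableSet (B k) := fun k =>
    measurableSet_Ioi.inter (kap_meas ε (measurableSet_singleton k))
  have hBd : Pairwise (Function.onFun Disjoint B) := by
    intro k l hkl
    rw [Function.onFun, Set.disjoint_left]
    rintro t ⟨_, h1⟩ ⟨_, h2⟩
    exact hkl (h1.symm.trans h2)
  have hBu : (⋃ k, B k) = Set.Ioi 0 := by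
    ext t
    simp [hB]
  have hr : μ.restrict (⋃ k, B k) = μ := by
    rw [hBu]
    apply Measure.restrict_eq_self_of_ae_mem
    rw [ae_iff]
    refine measure_mono_null ?_ hpos
    intro t ht
    simpa using ht
  have split : ∀ f : ℝ → ENNReal, ∫⁻ t, f t ∂μ = ∑' k, ∫⁻ t in B k, f t ∂μ := by
    intro f
    rw [← lintegral_iUnion hBm hBd, hr]
  have ex : ∀ k : ℤ, ∃ x : ℝ, ((1 - ε) ^ k ≤ x ∧ (1 - ε) * x < (1 - ε) ^ k) ∧
      ∫⁻ t in B k, g t ∂μ ≤ g x * μ (B k) := by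
    intro k
    by_cases h0 : μ (B k) = 0
    · exact ⟨_, AGood_pow hε k, by simp [Measure.restrict_eq_zero.mpr h0]⟩
    · obtain ⟨x, hx, hle⟩ := exists_setLAverage_le h0 (hBm k).nullMeasurableSet
        (ne_top_of_le_ne_top hfin (setLIntegral_le_lintegral _ _))
      have hk : kap ε x = k := hx.2
      refine ⟨x, ⟨hk ▸ kap_le hε hx.1, hk ▸ lt_kap hε hx.1⟩, ?_⟩
      rw [setLAverage_eq, ENNReal.div_le_iff h0 (measure_ne_top _ _)] at hle
      exact hle
  choose a ha hle using ex
  refine ⟨a, ha, ?_⟩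
  rw [split, split (fun t => g (rho ε a t))]
  apply ENNReal.tsum_le_tsum
  intro k
  refine (hle k).trans ?_
  rw [← setLIntegral_const]
  apply le_of_eq
  apply setLIntegral_congr_fun (hBm k)
  rintro t ⟨ht, hk⟩
  have hk : kap ε t = k := hk
  have ht : ¬ t ≤ 0 := not_le.mpr ht
  simp [rho, ht, hk]

lemma resample {n : ℕ} (D' : Fin n → Measure ℝ) [∀ i, IsProbabilityMeasure (D' i)] (i : Fin n)
    (f : (Fin n → ℝ) → ENNReal) (hf : Measurable f) :
    ∫⁻ v, f v ∂(Measure.pi D') =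
      ∫⁻ t, ∫⁻ v, f (Function.update v i t) ∂(Measure.pi D') ∂(D' i) := by
  have hmap : Measure.pi D' = Measure.map
      (fun q : (Fin n → ℝ) × ℝ => Function.update q.1 i q.2) ((Measure.pi D').prod (D' i)) := by
    apply Measure.pi_eq
    intro s hs
    rw [Measure.map_apply measurable_update' (MeasurableSet.univ_pi hs)]
    have : (fun q : (Fin n → ℝ) × ℝ => Function.update q.1 i q.2) ⁻¹' (Set.univ.pi s) =
        (Set.univ.pi (Function.update s i Set.univ)) ×ˢ (s i) := by
      ext ⟨v, t⟩
      simp only [Set.mem_preimage, Set.mem_pi, Set.mem_univ, true_imp_iff, Set.mem_prod]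
      constructor
      · intro h
        refine ⟨fun j => ?_, by simpa using h i⟩
        by_cases hj : j = i
        · subst hj; simp
        · simpa [hj] using h j
      · rintro ⟨h, ht⟩ j
        by_cases hj : j = i
        · subst hj; simpa using ht
        · simpa [hj] using h j
    rw [this, Measure.prod_prod, Measure.pi_pi, ← Finset.mul_prod_erase _ _ (Finset.mem_univ i),
      ← Finset.mul_prod_erase (a := i) Finset.univ (fun i => D' i (s i)) (Finset.mem_univ i)]
    simp only [Function.update_self, measure_univ, one_mul]
    rw [mul_comm]
    congr 1
    apply Finset.prod_congr rfl
    intro j hj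
    rw [Function.update_of_ne (Finset.ne_of_mem_erase hj)]
  conv_lhs => rw [hmap]
  rw [lintegral_map hf measurable_update', lintegral_prod_symm']
  exact hf.comp measurable_update'

lemma rep_all {n : ℕ} {ε : ℝ} (hε : ε ∈ Set.Ioo (0:ℝ) 1) (D' : Fin n → Measure ℝ)
    [∀ i, IsProbabilityMeasure (D' i)] (hpos : ∀ i, D' i (Set.Iic 0) = 0)
    (f : (Fin n → ℝ) → ENNReal) (hf : Measurable f) (C : ENNReal) (hC : C ≠ ⊤)
    (hfC : ∀ v, f v ≤ C) :
    ∃ a : Fin n → ℤ → ℝ, (∀ i, AGood ε (a i)) ∧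
      ∫⁻ v, f v ∂(Measure.pi D') ≤ ∫⁻ v, f (fun j => rho ε (a j) (v j)) ∂(Measure.pi D') := by
  have key : ∀ s : Finset (Fin n), ∃ a : Fin n → ℤ → ℝ, (∀ i, AGood ε (a i)) ∧
      ∫⁻ v, f v ∂(Measure.pi D') ≤
        ∫⁻ v, f (fun j => if j ∈ s then rho ε (a j) (v j) else v j) ∂(Measure.pi D') := by
    intro s
    induction s using Finset.induction_on with
    | empty => exact ⟨fun _ k => (1 - ε) ^ k, fun _ => AGood_pow hε, by simp⟩
    | insert i s his ih =>
      obtain ⟨a, ha, hle⟩ := ih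
      set F : (Fin n → ℝ) → ENNReal :=
        fun v => f (fun j => if j ∈ s then rho ε (a j) (v j) else v j) with hF
      have hFm : Measurable F := by
        apply hf.comp
        apply measurable_pi_lambda
        intro j
        by_cases hj : j ∈ s
        · simp only [hj, if_true]; exact (rho_meas ε (a j)).comp (measurable_pi_apply j)
        · simpa [hj] using measurable_pi_apply j
      have h1 := resample D' i F hFm
      have hfin : ∫⁻ v, F v ∂(Measure.pi D') ≠ ⊤ := by
        refine ne_top_of_le_ne_top hC ((lintegral_mono fun v => hfC _).trans ?_)
        simp
      rw [h1] at hfin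
      obtain ⟨b, hb, hble⟩ := choose_rep hε (D' i) (hpos i) _ hfin
      refine ⟨Function.update a i b, ?_, hle.trans (h1.le.trans (hble.trans ?_))⟩
      · intro j
        by_cases hj : j = i
        · subst hj; simpa using hb
        · simpa [hj] using ha j
      · have h2 := resample D' i (fun v => F (Function.update v i (rho ε b (v i))))
          (hFm.comp (measurable_update'.comp (measurable_id.prodMk
            ((rho_meas ε b).comp (measurable_pi_apply i)))))
        simp only [Function.update_self, Function.update_idem] at h2
        rw [← h2]
        apply le_of_eq
        congr 1
        ext v
        simp only [hF]
        congr 1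
        ext j
        by_cases hj : j = i
        · subst hj; simp [his]
        · simp [hj]
  simpa using key Finset.univ

/-- **Multiplicative discretization of the value space.** Rounding each
coordinate distribution of a product distribution `D'` on `(0,∞)ⁿ` down to the
closest power of `1-ε` loses at most a `1-ε` factor of the optimal revenue. -/
theorem opt_multiplicative_discretization {n : ℕ} (hn : 1 ≤ n)
    (ε : ℝ) (hε : ε ∈ Set.Ioo (0 : ℝ) 1)
    (D' : Fin n → Measure ℝ)
    (hprob : ∀ i, IsProbabilityMeasure (D' i))
    (hpos : ∀ i, D' i (Set.Iic 0) = 0) :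
    Opt (Measure.pi fun i => Measure.map (roundPow ε) (D' i))
      ≥ (1 - ε) * Opt (Measure.pi D') := by

  have hc : 0 < 1 - ε := by linarith [hε.2]
  have hG0 := rho_good (n := n) hε (a := fun _ k => (1 - ε) ^ k) (fun _ => AGood_pow hε)
  simp only [← roundPow_eq] at hG0
  have hrm : Measurable (roundPow ε) := rho_meas ε _
  have : ∀ i, IsProbabilityMeasure (Measure.map (roundPow ε) (D' i)) := fun i =>
    Measure.isProbabilityMeasure_map hrm.aemeasurable
  set E := Measure.pi fun i => Measure.map (roundPow ε) (D' i) with hE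
  set D := Measure.pi D' with hD
  have hRm : Measurable (fun (v : Fin n → ℝ) i => roundPow ε (v i)) :=
    measurable_pi_lambda _ fun j => hrm.comp (measurable_pi_apply j)
  have hmap : E = Measure.map (fun (v : Fin n → ℝ) i => roundPow ε (v i)) D :=
    (Measure.pi_map_pi fun i => hrm.aemeasurable).symm
  have hDpos : ∀ᵐ v ∂D, ∀ j, 0 ≤ v j := by
    rw [ae_all_iff]
    intro j
    have h1 : ∀ᵐ t ∂(D' j), 0 ≤ t := by
      rw [ae_iff]
      refine measure_mono_null ?_ (hpos j)
      intro t ht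
      exact (not_le.mp ht).le
    exact (measurePreserving_eval D' j).quasiMeasurePreserving.ae h1
  have hEpos : ∀ᵐ v ∂E, ∀ j, 0 ≤ v j := by
    rw [hmap, ae_map_iff hRm.aemeasurable (by measurability)]
    filter_upwards [hDpos] with v hv j
    exact hG0.nonneg j _ (hv j)
  have hpm : ∀ {M : Mech n}, M.Good → Measurable fun v => ENNReal.ofReal (∑ i, M.pay v i) :=
    fun hM => ENNReal.measurable_ofReal.comp (Finset.measurable_sum _ fun i _ => hM.2.2.2.2 i)
  by_cases hb : BddAbove {r : ℝ | ∃ M : Mech n, M.Good ∧ r = Rev M D}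
  swap
  · have : Opt D = 0 := Real.sSup_of_not_bddAbove hb
    rw [this, mul_zero]
    exact Opt_nonneg _
  have hbE : BddAbove {r : ℝ | ∃ M : Mech n, M.Good ∧ r = Rev M E} := by
    refine ⟨Opt D / (1 - ε), ?_⟩
    rintro r ⟨M, hM, rfl⟩
    have h1 := LRev_comp hM hc hG0 hDpos
    have h2 := LRev_le_Opt (Mech.comp_good hM hG0) hDpos hb
    have h3 : LRev M E =
        ∫⁻ v, ENNReal.ofReal (∑ i, M.pay (fun j => roundPow ε (v j)) i) ∂D := by
      unfold LRev
      rw [hmap, lintegral_map (hpm hM) hRm]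
    rw [← h3] at h1
    have h4 : ENNReal.ofReal (1 - ε) * ENNReal.ofReal (Rev M E) ≤ ENNReal.ofReal (Opt D) :=
      (mul_le_mul_right (ofReal_rev_le M E) _).trans (h1.trans h2)
    rw [← ENNReal.ofReal_mul hc.le, ENNReal.ofReal_le_ofReal_iff (Opt_nonneg D)] at h4
    rw [le_div_iff₀ hc]
    linarith
  have main : ∀ M : Mech n, M.Good → ENNReal.ofReal (1 - ε) * LRev M D ≤ ENNReal.ofReal (Opt E) := by
    intro M hM
    rw [mul_comm, ← ENNReal.le_div_iff_mul_le (Or.inl (ENNReal.ofReal_pos.mpr hc).ne') (by simp)]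
    by_contra hcon
    push Not at hcon
    obtain ⟨M', hM', ⟨T, hT⟩, hlt⟩ := bounded_approx hM hDpos hcon
    set f : (Fin n → ℝ) → ENNReal :=
      fun v => min (ENNReal.ofReal (∑ i, M'.pay v i)) (ENNReal.ofReal (n * T)) with hf
    obtain ⟨a, ha, hle⟩ := rep_all hε D' hpos f ((hpm hM').min measurable_const) _
      ENNReal.ofReal_ne_top (fun v => min_le_right _ _)
    have hG := rho_good hε ha
    have e1 : LRev M' D = ∫⁻ v, f v ∂D := by
      apply lintegral_congr_ae
      filter_upwards [hDpos] with v hv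
      rw [hf]
      symm
      apply min_eq_left
      apply ENNReal.ofReal_le_ofReal
      calc _ ≤ ∑ i : Fin n, T := Finset.sum_le_sum fun i _ => (hT v hv i).2
        _ = _ := by simp
    have h1 := LRev_comp hM' hc hG hEpos
    have h2 := LRev_le_Opt (Mech.comp_good hM' hG) hEpos hbE
    have h3 : ∫⁻ v, ENNReal.ofReal (∑ i, M'.pay (fun j => rho ε (a j) (v j)) i) ∂E =
        ∫⁻ v, ENNReal.ofReal (∑ i, M'.pay (fun j => rho ε (a j) (v j)) i) ∂D := by
      rw [hmap, lintegral_map _ hRm]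
      · simp only [rho_round hε]
      · exact (hpm hM').comp (measurable_pi_lambda _ fun j =>
          (rho_meas ε (a j)).comp (measurable_pi_apply j))
    rw [h3] at h1
    have h4 : LRev M' D ≤
        ∫⁻ v, ENNReal.ofReal (∑ i, M'.pay (fun j => rho ε (a j) (v j)) i) ∂D := by
      rw [e1]
      exact hle.trans (lintegral_mono fun v => min_le_left _ _)
    refine absurd hlt (not_lt.mpr ?_)
    rw [ENNReal.le_div_iff_mul_le (Or.inl (ENNReal.ofReal_pos.mpr hc).ne') (by simp), mul_comm]
    exact (mul_le_mul_right h4 _).trans (h1.trans h2)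
  have hfin : Opt D ≤ Opt E / (1 - ε) := by
    apply csSup_le ⟨0, zero_mem D⟩
    rintro r ⟨M, hM, rfl⟩
    have h4 := (mul_le_mul_right (ofReal_rev_le M D) _).trans (main M hM)
    rw [← ENNReal.ofReal_mul hc.le, ENNReal.ofReal_le_ofReal_iff (Opt_nonneg E)] at h4
    rw [le_div_iff₀ hc]
    linarith
  rw [le_div_iff₀ hc] at hfin
  rw [ge_iff_le, mul_comm]
  exact hfin
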